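/- Let Ω ⊂ ℝ^d be open, let g : Ω → {symmetric positive definite d×d real matrices} be smooth with determinant |g|, let X be a smooth real vector field on Ω with components X^j, and let u ∈ C^∞(Ω, ℂ). Define the covector A_j := (i/2) g_{jk}X^k (sum over k), the potential q := ¼ g_{jk}X^j X^k − ½ div_g X where div_g X := |g|^{-1/2} ∂_{x_j}(|g|^{1/2} X^j), the Laplace–Beltrami operator Δ_g u := |g|^{-1/2} ∂_{x_j}(|g|^{1/2} g^{jk} ∂_{x_k}u), and the magnetic Schrödinger operator L_{g,A,q}u := −|g|^{-1/2}(∂_{x_j} + iA_j)(|g|^{1/2} g^{jk}(∂_{x_k} + iA_k)u) + qu. Then at every point of Ω: L_{g,A,q}u = −(Δ_g u − X^k ∂_{x_k}u). In particular, u satisfies the advection–diffusion equation Δ_g u − X^k∂_{x_k}u = 0 in Ω if and only if L_{g,A,q}u = 0 in Ω. -/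

import Mathlib

noncomputable section

open scoped BigOperators

/-- Partial derivative `∂_j f` at `x`. -/
def pd {d : ℕ} {E : Type*} [NormedAddCommGroup E] [NormedSpace ℝ E]
    (j : Fin d) (f : (Fin d → ℝ) → E) (x : Fin d → ℝ) : E :=
  fderiv ℝ f x (Pi.single j 1)

/-- The magnetic covector `A_j = (i/2) g_{jk} X^k`. -/
def Asub {d : ℕ} (g : (Fin d → ℝ) → Matrix (Fin d) (Fin d) ℝ)
    (X : Fin d → (Fin d → ℝ) → ℝ) (j : Fin d) (x : Fin d → ℝ) : ℂ :=
  (Complex.I / 2) * ((∑ k : Fin d, g x j k * X k x : ℝ) : ℂ)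

/-- `div_g X = |g|^{-1/2} ∂_j(|g|^{1/2} X^j)`. -/
def divgV {d : ℕ} (g : (Fin d → ℝ) → Matrix (Fin d) (Fin d) ℝ)
    (X : Fin d → (Fin d → ℝ) → ℝ) (x : Fin d → ℝ) : ℝ :=
  (Real.sqrt (g x).det)⁻¹ *
    ∑ j : Fin d, pd j (fun y => Real.sqrt (g y).det * X j y) x

/-- The potential `q = ¼ g_{jk} X^j X^k − ½ div_g X`. -/
def qpot {d : ℕ} (g : (Fin d → ℝ) → Matrix (Fin d) (Fin d) ℝ)
    (X : Fin d → (Fin d → ℝ) → ℝ) (x : Fin d → ℝ) : ℝ :=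
  (1 / 4) * ∑ j : Fin d, ∑ k : Fin d, g x j k * X j x * X k x
    - (1 / 2) * divgV g X x

/-- `Δ_g u = |g|^{-1/2} ∂_j(|g|^{1/2} g^{jk} ∂_k u)` for a complex-valued `u`. -/
def lapC {d : ℕ} (g : (Fin d → ℝ) → Matrix (Fin d) (Fin d) ℝ)
    (u : (Fin d → ℝ) → ℂ) (x : Fin d → ℝ) : ℂ :=
  (((Real.sqrt (g x).det)⁻¹ : ℝ) : ℂ) *
    ∑ j : Fin d, pd j (fun y => ((Real.sqrt (g y).det : ℝ) : ℂ) *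
      ∑ k : Fin d, (((g y)⁻¹ j k : ℝ) : ℂ) * pd k u y) x

/-- The inner field `|g|^{1/2} g^{jk} (∂_k + iA_k) u` of the magnetic Schrödinger operator. -/
def Wf {d : ℕ} (g : (Fin d → ℝ) → Matrix (Fin d) (Fin d) ℝ)
    (X : Fin d → (Fin d → ℝ) → ℝ) (u : (Fin d → ℝ) → ℂ)
    (j : Fin d) (y : Fin d → ℝ) : ℂ :=
  ((Real.sqrt (g y).det : ℝ) : ℂ) *
    ∑ k : Fin d, (((g y)⁻¹ j k : ℝ) : ℂ) * (pd k u y + Complex.I * Asub g X k y * u y)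

/-- The magnetic Schrödinger operator
`L_{g,A,q} u = −|g|^{-1/2} (∂_j + iA_j)(|g|^{1/2} g^{jk} (∂_k + iA_k) u) + q u`. -/
def Lmag {d : ℕ} (g : (Fin d → ℝ) → Matrix (Fin d) (Fin d) ℝ)
    (X : Fin d → (Fin d → ℝ) → ℝ) (u : (Fin d → ℝ) → ℂ) (x : Fin d → ℝ) : ℂ :=
  -((((Real.sqrt (g x).det)⁻¹ : ℝ) : ℂ) *
      ∑ j : Fin d, (pd j (Wf g X u j) x + Complex.I * Asub g X j x * Wf g X u j x))
    + ((qpot g X x : ℝ) : ℂ) * u x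

theorem aux_det {d : ℕ} (M : (Fin d → ℝ) → Matrix (Fin d) (Fin d) ℝ) (x : Fin d → ℝ)
    (h : ∀ i j, DifferentiableAt ℝ (fun y => M y i j) x) :
    DifferentiableAt ℝ (fun y => (M y).det) x := by
  simp only [Matrix.det_apply']
  refine DifferentiableAt.fun_sum fun σ _ => ?_
  refine DifferentiableAt.const_mul ?_ _
  exact (HasFDerivAt.finsetProd (u := Finset.univ) fun i _ => (h (σ i) i).hasFDerivAt).differentiableAt

theorem aux_inv {d : ℕ} (M : (Fin d → ℝ) → Matrix (Fin d) (Fin d) ℝ) (x : Fin d → ℝ)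
    (h : ∀ i j, DifferentiableAt ℝ (fun y => M y i j) x) (h0 : (M x).det ≠ 0) (j k : Fin d) :
    DifferentiableAt ℝ (fun y => (M y)⁻¹ j k) x := by
  simp only [Matrix.inv_def, Matrix.smul_apply, Ring.inverse_eq_inv', smul_eq_mul,
    Matrix.adjugate_apply]
  refine ((aux_det M x h).inv h0).mul (aux_det _ x fun a b => ?_)
  simp only [Matrix.updateRow_apply]
  split_ifs
  · exact differentiableAt_const _
  · exact h _ _

theorem aux_ofReal {d : ℕ} {f : (Fin d → ℝ) → ℝ} {x : Fin d → ℝ}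
    (h : DifferentiableAt ℝ f x) : DifferentiableAt ℝ (fun y => ((f y : ℝ) : ℂ)) x :=
  Complex.ofRealCLM.differentiableAt.comp x h

theorem aux_pd_ofReal {d : ℕ} {f : (Fin d → ℝ) → ℝ} {x : Fin d → ℝ} (j : Fin d)
    (h : DifferentiableAt ℝ f x) : pd j (fun y => ((f y : ℝ) : ℂ)) x = ((pd j f x : ℝ) : ℂ) := by
  unfold pd
  have := (Complex.ofRealCLM.hasFDerivAt.comp x h.hasFDerivAt).fderiv
  have e : (fun y => ((f y : ℝ) : ℂ)) = (Complex.ofRealCLM ∘ f) := rfl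
  rw [e, this]
  simp

/-- algebraic form of the inner field -/
theorem aux_Wf {d : ℕ} (g : (Fin d → ℝ) → Matrix (Fin d) (Fin d) ℝ)
    (X : Fin d → (Fin d → ℝ) → ℝ) (u : (Fin d → ℝ) → ℂ) (j : Fin d) (y : Fin d → ℝ)
    (h0 : (g y).det ≠ 0) :
    Wf g X u j y = ((Real.sqrt (g y).det : ℝ) : ℂ) *
        ∑ k : Fin d, (((g y)⁻¹ j k : ℝ) : ℂ) * pd k u y
      - (1 / 2) * (((Real.sqrt (g y).det * X j y : ℝ) : ℂ) * u y) := by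
  have h1 : (g y)⁻¹.mulVec ((g y).mulVec fun k => X k y) = fun k => X k y := by
    rw [Matrix.mulVec_mulVec, Matrix.nonsing_inv_mul _ (isUnit_iff_ne_zero.mpr h0),
      Matrix.one_mulVec]
  have h2 : ∑ k, (g y)⁻¹ j k * ∑ l, g y k l * X l y = X j y := congrFun h1 j
  have h3 : ∑ k, (((g y)⁻¹ j k : ℝ) : ℂ) * (Complex.I * Asub g X k y * u y)
      = -(1 / 2) * ((X j y : ℝ) : ℂ) * u y := by
    rw [← h2, Complex.ofReal_sum, Finset.mul_sum, Finset.sum_mul]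
    refine Finset.sum_congr rfl fun k _ => ?_
    rw [Complex.ofReal_mul]
    unfold Asub
    linear_combination (((g y)⁻¹ j k : ℝ) : ℂ) * ((∑ l, g y k l * X l y : ℝ) : ℂ) * u y / 2
      * Complex.I_mul_I
  unfold Wf
  simp only [mul_add (((g y)⁻¹ j _ : ℝ) : ℂ), Finset.sum_add_distrib]
  rw [h3]
  push_cast
  ring

theorem aux_main {d : ℕ}
    (Ω : Set (Fin d → ℝ)) (hΩ : IsOpen Ω)
    (g : (Fin d → ℝ) → Matrix (Fin d) (Fin d) ℝ)
    (hg : ∀ i j, ContDiffOn ℝ (⊤ : ℕ∞) (fun y => g y i j) Ω)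
    (hgpd : ∀ x ∈ Ω, (g x).PosDef)
    (X : Fin d → (Fin d → ℝ) → ℝ)
    (hX : ∀ j, ContDiffOn ℝ (⊤ : ℕ∞) (X j) Ω)
    (u : (Fin d → ℝ) → ℂ) (hu : ContDiffOn ℝ (⊤ : ℕ∞) u Ω) (x : Fin d → ℝ) (hx : x ∈ Ω) :
    Lmag g X u x = -(lapC g u x - ∑ k : Fin d, ((X k x : ℝ) : ℂ) * pd k u x) := by
  have hn : Ω ∈ nhds x := hΩ.mem_nhds hx
  have dg : ∀ i j, DifferentiableAt ℝ (fun y => g y i j) x := fun i j =>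
    ((hg i j).contDiffAt hn).differentiableAt (by simp)
  have dX : ∀ j, DifferentiableAt ℝ (X j) x := fun j =>
    ((hX j).contDiffAt hn).differentiableAt (by simp)
  have du : DifferentiableAt ℝ u x := (hu.contDiffAt hn).differentiableAt (by simp)
  have dpu : ∀ k, DifferentiableAt ℝ (fun y => pd k u y) x := fun k => by
    have h : ContDiffAt ℝ 1 (fderiv ℝ u) x :=
      (hu.contDiffAt hn).fderiv_right (m := 1) (by norm_cast)
    exact (h.differentiableAt (by simp)).clm_apply (differentiableAt_const _)
  have hdet : 0 < (g x).det := (hgpd x hx).det_pos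
  have ds : DifferentiableAt ℝ (fun y => Real.sqrt (g y).det) x :=
    (aux_det g x dg).sqrt hdet.ne'
  have dF : ∀ j, DifferentiableAt ℝ (fun y => ((Real.sqrt (g y).det : ℝ) : ℂ) *
        ∑ k : Fin d, (((g y)⁻¹ j k : ℝ) : ℂ) * pd k u y) x := fun j =>
    (aux_ofReal ds).mul (DifferentiableAt.fun_sum fun k _ =>
      (aux_ofReal (aux_inv g x dg hdet.ne' j k)).mul (dpu k))
  have dsX : ∀ j, DifferentiableAt ℝ (fun y => Real.sqrt (g y).det * X j y) x := fun j =>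
    ds.mul (dX j)
  have hW : ∀ j, pd j (Wf g X u j) x = pd j (fun y => ((Real.sqrt (g y).det : ℝ) : ℂ) *
        ∑ k : Fin d, (((g y)⁻¹ j k : ℝ) : ℂ) * pd k u y) x
      - (1 / 2) * (((pd j (fun y => Real.sqrt (g y).det * X j y) x : ℝ) : ℂ) * u x
        + ((Real.sqrt (g x).det * X j x : ℝ) : ℂ) * pd j u x) := fun j => by
    have he : Wf g X u j =ᶠ[nhds x] fun y => ((Real.sqrt (g y).det : ℝ) : ℂ) *
        (∑ k : Fin d, (((g y)⁻¹ j k : ℝ) : ℂ) * pd k u y)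
      - (1 / 2) * (((Real.sqrt (g y).det * X j y : ℝ) : ℂ) * u y) := by
      filter_upwards [hn] with y hy
      exact aux_Wf g X u j y (hgpd y hy).det_pos.ne'
    rw [← aux_pd_ofReal j (dsX j)]
    have dm : DifferentiableAt ℝ (fun y => ((Real.sqrt (g y).det * X j y : ℝ) : ℂ) * u y) x :=
      (aux_ofReal (dsX j)).mul du
    unfold pd at *
    rw [he.fderiv_eq, fderiv_fun_sub (dF j) (dm.const_mul _),
      fderiv_const_mul dm, fderiv_fun_mul (aux_ofReal (dsX j)) du]
    simp only [ContinuousLinearMap.sub_apply, ContinuousLinearMap.smul_apply,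
      ContinuousLinearMap.add_apply, smul_eq_mul]
    ring
  have hs : ((Real.sqrt (g x).det : ℝ) : ℂ) ≠ 0 :=
    Complex.ofReal_ne_zero.mpr (Real.sqrt_pos.mpr hdet).ne'
  have hsymm : ∀ a b, (g x) a b = g x b a := fun a b => by
    simpa using (hgpd x hx).1.apply b a
  -- the zeroth order term
  have hA : ∀ j, Complex.I * Asub g X j x = -(1 / 2) * ((∑ k, g x j k * X k x : ℝ) : ℂ) :=
    fun j => by
      unfold Asub
      linear_combination ((∑ k, g x j k * X k x : ℝ) : ℂ) / 2 * Complex.I_mul_I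
  have h2 : ∀ k, ∑ j, (∑ l, g x j l * X l x) * (g x)⁻¹ j k = X k x := fun k => by
    have h1 : Matrix.vecMul (Matrix.vecMul (fun k => X k x) (g x)) (g x)⁻¹ = fun k => X k x := by
      rw [Matrix.vecMul_vecMul, Matrix.mul_nonsing_inv _ (isUnit_iff_ne_zero.mpr hdet.ne'),
        Matrix.vecMul_one]
    have h1k := congrFun h1 k
    simp only [Matrix.vecMul, dotProduct] at h1k
    rw [← h1k]
    refine Finset.sum_congr rfl fun j _ => ?_
    congr 1
    refine Finset.sum_congr rfl fun l _ => ?_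
    rw [hsymm j l, mul_comm]
  have hT1 : ∑ j, ((∑ l, g x j l * X l x : ℝ) : ℂ) *
      (∑ k : Fin d, (((g x)⁻¹ j k : ℝ) : ℂ) * pd k u x)
      = ∑ k, ((X k x : ℝ) : ℂ) * pd k u x := by
    simp only [Finset.mul_sum]
    rw [Finset.sum_comm]
    refine Finset.sum_congr rfl fun k _ => ?_
    rw [← h2 k, Complex.ofReal_sum, Finset.sum_mul]
    refine Finset.sum_congr rfl fun j _ => ?_
    rw [Complex.ofReal_mul]
    ring
  have hT2 : ∑ j, ((∑ l, g x j l * X l x : ℝ) : ℂ) * ((X j x : ℝ) : ℂ)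
      = ((∑ j : Fin d, ∑ k : Fin d, g x j k * X j x * X k x : ℝ) : ℂ) := by
    push_cast
    refine Finset.sum_congr rfl fun j _ => ?_
    rw [Finset.sum_mul]
    exact Finset.sum_congr rfl fun l _ => by ring
  have key : ∑ j, (pd j (Wf g X u j) x + Complex.I * Asub g X j x * Wf g X u j x)
      = ∑ j, pd j (fun y => ((Real.sqrt (g y).det : ℝ) : ℂ) *
        ∑ k : Fin d, (((g y)⁻¹ j k : ℝ) : ℂ) * pd k u y) x
      - (1 / 2) * u x * ∑ j, ((pd j (fun y => Real.sqrt (g y).det * X j y) x : ℝ) : ℂ)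
      - (1 / 2) * ((Real.sqrt (g x).det : ℝ) : ℂ) * ∑ k, ((X k x : ℝ) : ℂ) * pd k u x
      - (1 / 2) * ((Real.sqrt (g x).det : ℝ) : ℂ) *
        ∑ j, ((∑ l, g x j l * X l x : ℝ) : ℂ) *
          (∑ k : Fin d, (((g x)⁻¹ j k : ℝ) : ℂ) * pd k u x)
      + (1 / 4) * ((Real.sqrt (g x).det : ℝ) : ℂ) * u x *
        ∑ j, ((∑ l, g x j l * X l x : ℝ) : ℂ) * ((X j x : ℝ) : ℂ) := by
    rw [Finset.mul_sum (s := Finset.univ) (a := (1 / 2) * u x),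
      Finset.mul_sum (f := fun k => ((X k x : ℝ) : ℂ) * pd k u x),
      Finset.mul_sum (f := fun j => ((∑ l, g x j l * X l x : ℝ) : ℂ) *
          (∑ k : Fin d, (((g x)⁻¹ j k : ℝ) : ℂ) * pd k u x)),
      Finset.mul_sum (f := fun j => ((∑ l, g x j l * X l x : ℝ) : ℂ) * ((X j x : ℝ) : ℂ)),
      ← Finset.sum_sub_distrib, ← Finset.sum_sub_distrib, ← Finset.sum_sub_distrib,
      ← Finset.sum_add_distrib]
    refine Finset.sum_congr rfl fun j _ => ?_
    rw [hW j, hA j, aux_Wf g X u j x hdet.ne', Complex.ofReal_mul]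
    ring
  unfold Lmag lapC qpot divgV
  rw [key, hT1, hT2]
  simp only [Complex.ofReal_sub, Complex.ofReal_mul, Complex.ofReal_inv]
  rw [Complex.ofReal_sum (f := fun j => pd j (fun y => Real.sqrt (g y).det * X j y) x)]
  generalize ((∑ j : Fin d, ∑ k : Fin d, g x j k * X j x * X k x : ℝ) : ℂ) = Q
  push_cast
  field_simp
  ring

/-- The advection–diffusion operator `Δ_g − X` rewritten as a magnetic Schrödinger operator
with `A = i X♭ / 2` and `q = ¼ g(X,X) − ½ div_g X`:
`L_{g,A,q} u = −(Δ_g u − X^k ∂_k u)` on `Ω`; in particular `u` solves the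
advection–diffusion equation on `Ω` iff `L_{g,A,q} u = 0` on `Ω`. -/
theorem Lmag_eq_neg_advection_diffusion {d : ℕ}
    (Ω : Set (Fin d → ℝ)) (hΩ : IsOpen Ω)
    (g : (Fin d → ℝ) → Matrix (Fin d) (Fin d) ℝ)
    (hg : ∀ i j, ContDiffOn ℝ (⊤ : ℕ∞) (fun y => g y i j) Ω)
    (hgpd : ∀ x ∈ Ω, (g x).PosDef)
    (X : Fin d → (Fin d → ℝ) → ℝ)
    (hX : ∀ j, ContDiffOn ℝ (⊤ : ℕ∞) (X j) Ω)
    (u : (Fin d → ℝ) → ℂ) (hu : ContDiffOn ℝ (⊤ : ℕ∞) u Ω) :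
    (∀ x ∈ Ω,
        Lmag g X u x = -(lapC g u x - ∑ k : Fin d, ((X k x : ℝ) : ℂ) * pd k u x))
    ∧ ((∀ x ∈ Ω, lapC g u x - ∑ k : Fin d, ((X k x : ℝ) : ℂ) * pd k u x = 0)
        ↔ (∀ x ∈ Ω, Lmag g X u x = 0)) := by
  have h := aux_main Ω hΩ g hg hgpd X hX u hu
  refine ⟨h, ?_, ?_⟩
  · intro H x hx
    rw [h x hx, H x hx, neg_zero]
  · intro H x hx
    have := h x hx
    rw [H x hx] at this
    exact neg_eq_zero.mp this.symm
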